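/- Let Z₁^ε be the normalization constant of the Gaussian measure on ℋ^{L,a} with density proportional to exp(−(2ε)^{-1} ∫_{D_L}|∇h|² dz), and let Z₃^{ε,κ} be the normalization constant of the massive Gaussian measure on ℋ₀^{L,a} with density proportional to exp(−κ(2ε)^{-1} ∫_{D_L}[|∇h|² + h²] dz). Then there is a constant C > 0 such that exp(1/(εL)) κ^{−N/2} (1 + CL²)^{−N/2} ≤ Z₃^{ε,κ} / Z₁^ε ≤ exp(1/(εL)) κ^{−N/2}. -/

import Mathlib

open MeasureTheory Real Filter Topology
open scoped ENNReal RealInnerProductSpace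

noncomputable section

/-- `Eucl d` is the Euclidean space `ℝ^(d+1)`. -/
abbrev Eucl (d : ℕ) : Type := EuclideanSpace ℝ (Fin (d + 1))

/-- The unbounded domain `D = ℝ × (0,1)^d`, as a subset of `ℝ^(d+1)`. -/
def domD (d : ℕ) : Set (Eucl d) := {z | ∀ i : Fin d, z i.succ ∈ Set.Ioo (0 : ℝ) 1}

/-- The bounded domain `D_L = (-L,L) × (0,1)^d`. -/
def domDL (d : ℕ) (L : ℝ) : Set (Eucl d) :=
  {z | |z 0| < L ∧ ∀ i : Fin d, z i.succ ∈ Set.Ioo (0 : ℝ) 1}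

/-- The standing assumptions on the symmetric double well potential `F`. -/
structure IsStdPotential (F : ℝ → ℝ) : Prop where
  smooth : ContDiff ℝ 3 F
  symm : ∀ u, F (-u) = F u
  nonneg : ∀ u, 0 ≤ F u
  zero_iff : ∀ u, F u = 0 ↔ u = 1 ∨ u = -1
  deriv_zero_iff : ∀ u, deriv F u = 0 ↔ u = 0 ∨ u = 1 ∨ u = -1
  dd_zero_neg : deriv (deriv F) 0 < 0
  dd_one_pos : 0 < deriv (deriv F) 1
  dd_neg_one_pos : 0 < deriv (deriv F) (-1)

/-- The surface tension `C* = ∫_{-1}^1 √(2 F(u)) du`. -/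
def Cstar (F : ℝ → ℝ) : ℝ := ∫ u in (-1 : ℝ)..1, Real.sqrt (2 * F u)

/-- `m` is the optimal transition profile for the potential `F`: a solution of
`m' = √(2F(m))`, `m(±∞) = ±1`, `m(0) = 0`, with values in `[-1,1]`. -/
structure IsProfile (F m : ℝ → ℝ) : Prop where
  mem_Icc : ∀ x, m x ∈ Set.Icc (-1 : ℝ) 1
  ode : ∀ x, HasDerivAt m (Real.sqrt (2 * F (m x))) x
  limit_top : Tendsto m atTop (nhds 1)
  limit_bot : Tendsto m atBot (nhds (-1))
  zero : m 0 = 0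

/-- `z` is a point of the lattice `aℤ^(d+1)`. -/
def latticePt (d : ℕ) (a : ℝ) (z : Eucl d) : Prop := ∀ i, ∃ k : ℤ, z i = a * k

/-- The grid `D_{L,a} = cl(D_{L-a}) ∩ aℤ^(d+1)`. -/
def gridSet (d : ℕ) (L a : ℝ) : Set (Eucl d) :=
  {z | latticePt d a z ∧ |z 0| ≤ L - a ∧ ∀ i : Fin d, z i.succ ∈ Set.Icc (0 : ℝ) 1}

/-- `h` is piecewise linear w.r.t. the lattice of mesh `a`: it is continuous and affine on
each simplex of the standard (Kuhn) subdivision of each lattice cube into simplices. -/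
def IsPLGrid (d : ℕ) (a : ℝ) (h : Eucl d → ℝ) : Prop :=
  Continuous h ∧
  ∀ (p : Fin (d + 1) → ℤ) (σp : Equiv.Perm (Fin (d + 1))),
    ∃ φ : Eucl d →ᵃ[ℝ] ℝ,
      ∀ z : Eucl d, (∀ i, a * p i ≤ z i ∧ z i ≤ a * p i + a) →
        (∀ k l : Fin (d + 1), k ≤ l → z (σp l) - a * (p (σp l)) ≤ z (σp k) - a * (p (σp k))) →
        h z = φ z

/-- The discretized configuration space `ℋ^{L,a}` of piecewise linear functions with
boundary values `±1`, presented through the linear interpolation operator `interp0`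
(zero boundary values, determined by the values on the grid and vanishing at all other
lattice points) and the fixed piecewise linear profile `bc` implementing the `±1`
boundary values.  Thus `ℋ^{L,a} = {bc + interp0 g}` and `ℋ₀^{L,a} = {interp0 g}`, where
`g` ranges over all functions on the grid, and both spaces are identified with `ℝ^N`
via the coordinates `g`. -/
structure Disc (d : ℕ) (L a : ℝ) where
  gridFin : Fintype (gridSet d L a)
  interp0 : ((gridSet d L a) → ℝ) →ₗ[ℝ] ((Eucl d) → ℝ)
  bc : Eucl d → ℝ
  interp0_grid : ∀ (g) (z : Eucl d) (hz : z ∈ gridSet d L a), interp0 g z = g ⟨z, hz⟩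
  interp0_lattice : ∀ (g) (z : Eucl d), latticePt d a z → z ∉ gridSet d L a → interp0 g z = 0
  interp0_bd : ∀ (g) (z : Eucl d), L ≤ |z 0| → interp0 g z = 0
  interp0_pl : ∀ g, IsPLGrid d a (interp0 g)
  bc_grid : ∀ z ∈ gridSet d L a, bc z = 0
  bc_lattice_pos : ∀ z : Eucl d, latticePt d a z → z ∉ gridSet d L a → 0 < z 0 → bc z = 1
  bc_lattice_neg : ∀ z : Eucl d, latticePt d a z → z ∉ gridSet d L a → z 0 < 0 → bc z = -1
  bc_plus : ∀ z : Eucl d, L ≤ z 0 → bc z = 1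
  bc_minus : ∀ z : Eucl d, z 0 ≤ -L → bc z = -1
  bc_pl : IsPLGrid d a bc

/-- The number of grid points, `N = dim ℋ^{L,a}`. -/
def gridCard (d : ℕ) (L a : ℝ) (disc : Disc d L a) : ℕ :=
  letI := disc.gridFin; Fintype.card (gridSet d L a)

/-- Lebesgue measure `𝓛^N` on `ℋ^{L,a} ≅ ℝ^N` (in grid coordinates). -/
def gridVol (d : ℕ) (L a : ℝ) (disc : Disc d L a) : Measure ((gridSet d L a) → ℝ) :=
  letI := disc.gridFin; Measure.pi fun _ => (volume : Measure ℝ)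

/-- The element of `ℋ^{L,a}` with grid values `g` (extended by `±1` to all of `ℝ^(d+1)`). -/
def discFun (d : ℕ) (L a : ℝ) (disc : Disc d L a) (g : (gridSet d L a) → ℝ) : Eucl d → ℝ :=
  fun z => disc.bc z + disc.interp0 g z

/-- The Dirichlet energy `∫_{D_L} |∇h|²`. -/
def dirEnergy (d : ℕ) (L : ℝ) (h : Eucl d → ℝ) : ℝ := ∫ z in domDL d L, ‖fderiv ℝ h z‖ ^ 2

/-- The squared `H¹(D_L)` norm `∫_{D_L} |∇h|² + h²`. -/
def sobNormSq (d : ℕ) (L : ℝ) (h : Eucl d → ℝ) : ℝ :=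
  ∫ z in domDL d L, (‖fderiv ℝ h z‖ ^ 2 + (h z) ^ 2)

/-- The potential energy `∫_{D_L} F(h)`. -/
def potEnergy (d : ℕ) (L : ℝ) (F : ℝ → ℝ) (h : Eucl d → ℝ) : ℝ :=
  ∫ z in domDL d L, F (h z)

/-- The energy `∫_{D_L} ½|∇h|² + F(h)`. -/
def fullEnergy (d : ℕ) (L : ℝ) (F : ℝ → ℝ) (h : Eucl d → ℝ) : ℝ :=
  ∫ z in domDL d L, (1/2 * ‖fderiv ℝ h z‖ ^ 2 + F (h z))

/-- Normalization constant `Z₁^ε` of the Gaussian measure `ν₁^ε`. -/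
def Z1 (d : ℕ) (L a : ℝ) (disc : Disc d L a) (ε : ℝ) : ℝ :=
  ∫ g, Real.exp (-(1/(2*ε)) * dirEnergy d L (discFun d L a disc g)) ∂(gridVol d L a disc)

/-- Normalization constant `Z₂^ε` of the unscaled Gaussian measure `ν₂^ε`. -/
def Z2 (d : ℕ) (L a : ℝ) (disc : Disc d L a) : ℝ :=
  ∫ g, Real.exp (-(1/2) * dirEnergy d L (discFun d L a disc g)) ∂(gridVol d L a disc)

/-- Normalization constant `Z₃^{ε,κ}` of the massive Gaussian measure `ρ^ε_κ` on `ℋ₀^{L,a}`. -/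
def Z3 (d : ℕ) (L a : ℝ) (disc : Disc d L a) (ε κ : ℝ) : ℝ :=
  ∫ g, Real.exp (-(κ/(2*ε)) * sobNormSq d L (disc.interp0 g)) ∂(gridVol d L a disc)

/-- Normalization constant `Z^{L,a,ε}` of the Gibbs measure `μ^{L,a,ε}`. -/
def Zmu (d : ℕ) (L a : ℝ) (disc : Disc d L a) (F : ℝ → ℝ) (ε : ℝ) : ℝ :=
  ∫ g, Real.exp (-(1/ε) * fullEnergy d L F (discFun d L a disc g)) ∂(gridVol d L a disc)

/-- The Gibbs measure `μ^{L,a,ε}`, in grid coordinates. -/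
def gibbs (d : ℕ) (L a : ℝ) (disc : Disc d L a) (F : ℝ → ℝ) (ε : ℝ) :
    Measure ((gridSet d L a) → ℝ) :=
  (gridVol d L a disc).withDensity fun g =>
    ENNReal.ofReal
      (Real.exp (-(1/ε) * fullEnergy d L F (discFun d L a disc g)) / Zmu d L a disc F ε)

/-- The massive Gaussian measure `ρ^ε_κ` on `ℋ₀^{L,a}`, in grid coordinates. -/
def rhoMeas (d : ℕ) (L a : ℝ) (disc : Disc d L a) (ε κ : ℝ) :
    Measure ((gridSet d L a) → ℝ) :=
  (gridVol d L a disc).withDensity fun g =>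
    ENNReal.ofReal
      (Real.exp (-(κ/(2*ε)) * sobNormSq d L (disc.interp0 g)) / Z3 d L a disc ε κ)

/-- The Gaussian measure `ν₁^ε` (scaled discrete free field with `±1` boundary values),
in grid coordinates. -/
def nu1 (d : ℕ) (L a : ℝ) (disc : Disc d L a) (ε : ℝ) : Measure ((gridSet d L a) → ℝ) :=
  (gridVol d L a disc).withDensity fun g =>
    ENNReal.ofReal
      (Real.exp (-(1/(2*ε)) * dirEnergy d L (discFun d L a disc g)) / Z1 d L a disc ε)

/-- Sum of the squared grid values. -/
def sumSq (d : ℕ) (L a : ℝ) (disc : Disc d L a) (g : (gridSet d L a) → ℝ) : ℝ :=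
  letI := disc.gridFin; ∑ z, (g z) ^ 2


open scoped NNReal

/-- A continuous function on a convex set which is Lipschitz on each of finitely many closed
pieces covering the set is Lipschitz. -/
theorem lipschitzOnWith_of_finite_closed_cover {E ι : Type*} [NormedAddCommGroup E]
    [NormedSpace ℝ E] [Finite ι] {S : Set E} (hS : Convex ℝ S) {f : E → ℝ}
    (hf : ContinuousOn f S) {C : ι → Set E} (hC : ∀ i, IsClosed (C i))
    (hcov : S ⊆ ⋃ i, C i) {K : ℝ≥0} (hK : ∀ i, LipschitzOnWith K f (C i ∩ S)) :
    LipschitzOnWith K f S := by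
  refine LipschitzOnWith.of_le_add_mul K fun y hy x hx => ?_
  set γ : ℝ → E := fun t => AffineMap.lineMap x y t with hγ
  have γcont : Continuous γ := AffineMap.lineMap_continuous
  have γmem : ∀ t ∈ Set.Icc (0 : ℝ) 1, γ t ∈ S := fun t ht => hS.lineMap_mem hx hy ht
  have γdist : ∀ s t, dist (γ s) (γ t) = dist s t * dist x y := fun s t =>
    dist_lineMap_lineMap x y s t
  have key : ∀ ⦃t⦄, t ∈ Set.Icc (0 : ℝ) 1 → f (γ t) ≤ f x + K * dist x y * t := by
    refine image_le_of_liminf_slope_right_le_deriv_boundary (B' := fun _ => K * dist x y)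
      (hf.comp γcont.continuousOn γmem) (by simp [hγ]) (by fun_prop) (fun t _ => ?_) ?_
    · have := ((hasDerivAt_id t).const_mul (K * dist x y)).const_add (f x)
      simpa using this.hasDerivWithinAt
    · intro t ht r hr
      have hev : ∀ᶠ z in 𝓝[>] t, z ∈ Set.Ioo t 1 := Ioo_mem_nhdsGT ht.2
      obtain ⟨i, hi⟩ : ∃ i, ∃ᶠ z in 𝓝[>] t, γ z ∈ C i := by
        by_contra hcon
        push Not at hcon
        obtain ⟨z, hz, hz'⟩ := ((eventually_all.2 hcon).and hev).exists
        obtain ⟨i, hi⟩ := Set.mem_iUnion.1 (hcov (γmem z ⟨ht.1.trans hz'.1.le, hz'.2.le⟩))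
        exact hz i hi
      have hti : γ t ∈ C i := (hC i).mem_of_frequently_of_tendsto hi
        (γcont.continuousAt.tendsto.mono_left nhdsWithin_le_nhds)
      refine (hi.and_eventually hev).mono fun z hz => ?_
      have hz0 : 0 < z - t := sub_pos.2 hz.2.1
      have h1 := (hK i).dist_le_mul (γ z) ⟨hz.1, γmem z ⟨ht.1.trans hz.2.1.le, hz.2.2.le⟩⟩
        (γ t) ⟨hti, γmem t ⟨ht.1, ht.2.le⟩⟩
      rw [γdist, Real.dist_eq, Real.dist_eq, abs_of_pos hz0] at h1
      refine lt_of_le_of_lt ?_ hr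
      rw [slope_def_field, div_le_iff₀ hz0]
      have := le_abs_self (f (γ z) - f (γ t))
      simp only [Function.comp]
      nlinarith
  have := key (Set.right_mem_Icc.2 zero_le_one)
  simpa [hγ, dist_comm] using this

theorem LipschitzOnWith.exists_mul_of_isCompact {X : Type*} [PseudoMetricSpace X] {s : Set X}
    (hs : IsCompact s) {f g : X → ℝ} {K K' : ℝ≥0} (hf : LipschitzOnWith K f s)
    (hg : LipschitzOnWith K' g s) : ∃ M, LipschitzOnWith M (fun x => f x * g x) s := by
  obtain ⟨a, ha⟩ := hs.exists_bound_of_continuousOn hf.continuousOn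
  obtain ⟨b, hb⟩ := hs.exists_bound_of_continuousOn hg.continuousOn
  have h0 : ∀ t : ℝ, t ≤ t.toNNReal := Real.le_coe_toNNReal
  refine ⟨a.toNNReal * K' + b.toNNReal * K, LipschitzOnWith.of_dist_le_mul fun x hx y hy => ?_⟩
  have h1 := hf.dist_le_mul x hx y hy
  have h2 := hg.dist_le_mul x hx y hy
  have hax := (ha x hx).trans (h0 a)
  have hby := (hb y hy).trans (h0 b)
  rw [Real.dist_eq] at h1 h2 ⊢
  rw [Real.norm_eq_abs] at hax hby
  calc |f x * g x - f y * g y| = |f x * (g x - g y) + (f x - f y) * g y| := by ring_nf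
    _ ≤ |f x| * |g x - g y| + |f x - f y| * |g y| := by
      rw [← abs_mul, ← abs_mul]; exact abs_add_le _ _
    _ ≤ a.toNNReal * (K' * dist x y) + (K * dist x y) * b.toNNReal := by gcongr
    _ = _ := by push_cast; ring

/-- Integrals of squared norms of almost everywhere linear families are continuous. -/
theorem continuous_integral_norm_sq {V α F : Type*} [NormedAddCommGroup V] [NormedSpace ℝ V]
    [FiniteDimensional ℝ V] [NormedAddCommGroup F] [NormedSpace ℝ F] [MeasurableSpace α]
    {μ : Measure α} (T : V → α → F)
    (hT : ∀ g h : V, ∀ s t : ℝ, T (s • g + t • h) =ᵐ[μ] fun z => s • T g z + t • T h z)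
    (hint : ∀ g, Integrable (fun z => ‖T g z‖ ^ 2) μ) :
    Continuous fun g => ∫ z, ‖T g z‖ ^ 2 ∂μ := by
  have hconv : ConvexOn ℝ Set.univ fun g => ∫ z, ‖T g z‖ ^ 2 ∂μ := by
    refine ⟨convex_univ, fun g _ h _ s t hs ht hst => ?_⟩
    simp only [smul_eq_mul]
    rw [← integral_const_mul, ← integral_const_mul,
      ← integral_add ((hint g).const_mul s) ((hint h).const_mul t)]
    refine integral_mono_ae (hint _) (((hint g).const_mul s).add ((hint h).const_mul t)) ?_
    filter_upwards [hT g h s t] with z hz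
    rw [hz]
    have h1 : ‖s • T g z + t • T h z‖ ≤ s * ‖T g z‖ + t * ‖T h z‖ := by
      refine (norm_add_le _ _).trans ?_
      rw [norm_smul, norm_smul, Real.norm_of_nonneg hs, Real.norm_of_nonneg ht]
    refine (pow_le_pow_left₀ (norm_nonneg _) h1 2).trans ?_
    obtain rfl : t = 1 - s := by linarith
    nlinarith [mul_nonneg (mul_nonneg hs ht) (sq_nonneg (‖T g z‖ - ‖T h z‖))]
  exact continuousOn_univ.1 (hconv.continuousOn isOpen_univ)

theorem exists_pos_mul_norm_sq_le {V : Type*} [NormedAddCommGroup V] [NormedSpace ℝ V]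
    [FiniteDimensional ℝ V] {E : V → ℝ} (hE : Continuous E)
    (hom : ∀ (t : ℝ) g, E (t • g) = t ^ 2 * E g) (pos : ∀ g, g ≠ 0 → 0 < E g) :
    ∃ m, 0 < m ∧ ∀ g, m * ‖g‖ ^ 2 ≤ E g := by
  have h0 : E 0 = 0 := by simpa using hom 0 0
  rcases (Metric.sphere (0 : V) 1).eq_empty_or_nonempty with hemp | hne
  · refine ⟨1, one_pos, fun g => ?_⟩
    by_cases hg : g = 0
    · simp [hg, h0]
    · exact absurd (by simp [norm_smul, hg] : ‖g‖⁻¹ • g ∈ Metric.sphere (0 : V) 1)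
        (by simp [hemp])
  · obtain ⟨x, hx, hmin⟩ := (isCompact_sphere (0 : V) 1).exists_isMinOn hne hE.continuousOn
    refine ⟨E x, pos x (ne_zero_of_mem_unit_sphere ⟨x, hx⟩), fun g => ?_⟩
    by_cases hg : g = 0
    · simp [hg, h0]
    · have h1 : E x ≤ E (‖g‖⁻¹ • g) :=
        hmin (by simp [norm_smul, hg] : ‖g‖⁻¹ • g ∈ Metric.sphere (0 : V) 1)
      have hg' : 0 < ‖g‖ := norm_pos_iff.2 hg
      rw [hom, inv_pow, inv_mul_eq_div, le_div_iff₀ (by positivity)] at h1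
      exact h1

theorem integrable_exp_neg_of_coercive {ι : Type*} [Fintype ι] {E : (ι → ℝ) → ℝ}
    (hE : Continuous E) {m : ℝ} (hm : 0 < m) (hmE : ∀ g, m * ‖g‖ ^ 2 ≤ E g) {c : ℝ}
    (hc : 0 < c) : Integrable (fun g => Real.exp (-c * E g)) := by
  set b : ℝ := c * m / (Fintype.card ι + 1) with hb
  have hbpos : 0 < b := by positivity
  have hprod : Integrable (fun g : ι → ℝ => ∏ i, Real.exp (-b * g i ^ 2)) :=
    Integrable.fintype_prod fun _ => integrable_exp_neg_mul_sq hbpos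
  refine hprod.mono' (by fun_prop) (ae_of_all _ fun g => ?_)
  rw [Real.norm_of_nonneg (Real.exp_pos _).le, ← Real.exp_sum, Real.exp_le_exp,
    ← Finset.mul_sum]
  have hsum : ∑ i, g i ^ 2 ≤ (Fintype.card ι + 1) * ‖g‖ ^ 2 := by
    calc ∑ i, g i ^ 2 ≤ ∑ _i : ι, ‖g‖ ^ 2 := Finset.sum_le_sum fun i _ => by
            rw [← sq_abs]; exact pow_le_pow_left₀ (abs_nonneg _) (norm_le_pi_norm g i) 2
      _ = Fintype.card ι * ‖g‖ ^ 2 := by simp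
      _ ≤ _ := by nlinarith [sq_nonneg ‖g‖]
  have h1 : b * ∑ i, g i ^ 2 ≤ c * (m * ‖g‖ ^ 2) := by
    calc b * ∑ i, g i ^ 2 ≤ b * ((Fintype.card ι + 1) * ‖g‖ ^ 2) := by gcongr
      _ = _ := by rw [hb]; field_simp
  nlinarith [mul_le_mul_of_nonneg_left (hmE g) hc.le]

theorem integral_exp_neg_mul_of_homogeneous {ι : Type*} [Fintype ι] {E : (ι → ℝ) → ℝ}
    (hom : ∀ (t : ℝ) g, E (t • g) = t ^ 2 * E g) {r : ℝ} (hr : 0 < r) (c : ℝ) :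
    ∫ g, Real.exp (-(r * c) * E g)
      = r ^ (-(Fintype.card ι : ℝ) / 2) * ∫ g, Real.exp (-c * E g) := by
  have h1 := Measure.integral_comp_smul_of_nonneg (volume : Measure (ι → ℝ))
    (fun g => Real.exp (-c * E g)) (√r) (hR := Real.sqrt_nonneg r)
  have h2 : ∀ g, -c * E (√r • g) = -(r * c) * E g := fun g => by
    rw [hom, Real.sq_sqrt hr.le]; ring
  simp only [h2, Module.finrank_fintype_fun_eq_card, smul_eq_mul] at h1
  rw [h1, Real.sqrt_eq_rpow, ← Real.rpow_natCast, ← Real.rpow_mul hr.le, ← Real.rpow_neg hr.le]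
  congr 2
  ring

/-- Comparison of Gaussian integrals of two comparable quadratic functionals. -/
theorem gaussian_integral_comparison {ι : Type*} [Fintype ι] {E S : (ι → ℝ) → ℝ}
    (hE : Continuous E) (hS : Continuous S) (hom : ∀ (t : ℝ) g, E (t • g) = t ^ 2 * E g)
    (pos : ∀ g, g ≠ 0 → 0 < E g) (hES : ∀ g, E g ≤ S g) {M : ℝ} (hM : 0 < M)
    (hSE : ∀ g, S g ≤ M * E g) {c κ : ℝ} (hc : 0 < c) (hκ : 0 < κ) :
    0 < ∫ g, Real.exp (-c * E g) ∧
    κ ^ (-(Fintype.card ι : ℝ) / 2) * M ^ (-(Fintype.card ι : ℝ) / 2) *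
        ∫ g, Real.exp (-c * E g) ≤ ∫ g, Real.exp (-(κ * c) * S g) ∧
    ∫ g, Real.exp (-(κ * c) * S g)
      ≤ κ ^ (-(Fintype.card ι : ℝ) / 2) * ∫ g, Real.exp (-c * E g) := by
  obtain ⟨m, hm, hmE⟩ := exists_pos_mul_norm_sq_le hE hom pos
  have hint : ∀ {c : ℝ}, 0 < c → Integrable (fun g => Real.exp (-c * E g)) := fun hc =>
    integrable_exp_neg_of_coercive hE hm hmE hc
  have hintS : Integrable (fun g => Real.exp (-(κ * c) * S g)) :=
    integrable_exp_neg_of_coercive hS hm (fun g => (hmE g).trans (hES g)) (by positivity)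
  refine ⟨integral_exp_pos (hint hc), ?_, ?_⟩
  · rw [← Real.mul_rpow hκ.le hM.le, ← integral_exp_neg_mul_of_homogeneous hom (by positivity)]
    refine integral_mono (hint (by positivity)) hintS fun g => Real.exp_le_exp.2 ?_
    have := mul_le_mul_of_nonneg_left (hSE g) (mul_pos hκ hc).le
    linarith
  · rw [← integral_exp_neg_mul_of_homogeneous hom hκ]
    refine integral_mono hintS (hint (by positivity)) fun g => Real.exp_le_exp.2 ?_
    have := mul_le_mul_of_nonneg_left (hES g) (mul_pos hκ hc).le
    linarith

/-- The closed box `[-L,L] × [0,1]^d`. -/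
def closedBox (d : ℕ) (L : ℝ) : Set (Eucl d) :=
  {z | |z 0| ≤ L ∧ ∀ i : Fin d, z i.succ ∈ Set.Icc (0 : ℝ) 1}

/-- The identification of `ℝ × ℝ^d` with `ℝ^(d+1)`, separating the longitudinal coordinate. -/
def slabEquiv (d : ℕ) : ℝ × (Fin d → ℝ) ≃ᵐ Eucl d :=
  (MeasurableEquiv.piFinSuccAbove (fun _ : Fin (d + 1) => ℝ) 0).symm.trans
    (MeasurableEquiv.toLp 2 (Fin (d + 1) → ℝ))

/-- The cross-section `(0,1)^d`. -/
def crossSection (d : ℕ) : Set (Fin d → ℝ) := Set.univ.pi fun _ => Set.Ioo (0 : ℝ) 1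

/-- The longitudinal unit vector. -/
def longVec (d : ℕ) : Eucl d := EuclideanSpace.single 0 1

theorem longVec_zero (d : ℕ) : longVec d 0 = 1 := by simp [longVec]

theorem longVec_succ (d : ℕ) (i : Fin d) : longVec d i.succ = 0 := by simp [longVec]

theorem norm_longVec (d : ℕ) : ‖longVec d‖ = 1 := by simp [longVec]

theorem slabEquiv_zero (d : ℕ) (t : ℝ) (y : Fin d → ℝ) : slabEquiv d (t, y) 0 = t := by
  simp [slabEquiv, MeasurableEquiv.piFinSuccAbove_symm_apply, Fin.insertNthEquiv]

theorem slabEquiv_succ (d : ℕ) (t : ℝ) (y : Fin d → ℝ) (i : Fin d) :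
    slabEquiv d (t, y) i.succ = y i := by
  simp [slabEquiv, MeasurableEquiv.piFinSuccAbove_symm_apply, Fin.insertNthEquiv]

theorem slabEquiv_eq (d : ℕ) (t : ℝ) (y : Fin d → ℝ) :
    slabEquiv d (t, y) = slabEquiv d (0, y) + t • longVec d := by
  ext i
  refine Fin.cases ?_ (fun j => ?_) i
  · simp [slabEquiv_zero, longVec_zero]
  · simp [slabEquiv_succ, longVec_succ]

theorem measurePreserving_slabEquiv (d : ℕ) : MeasurePreserving (slabEquiv d) :=
  ((volume_preserving_piFinSuccAbove (fun _ : Fin (d + 1) => ℝ) 0).symm _).trans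
    (PiLp.volume_preserving_toLp (Fin (d + 1)))

theorem slabEquiv_preimage (d : ℕ) (L : ℝ) :
    slabEquiv d ⁻¹' domDL d L = Set.Ioo (-L) L ×ˢ crossSection d := by
  ext ⟨t, y⟩
  simp [domDL, crossSection, slabEquiv_zero, slabEquiv_succ, abs_lt]

theorem isOpen_domDL (d : ℕ) (L : ℝ) : IsOpen (domDL d L) := by
  have h : domDL d L = {z | |z 0| < L} ∩ ⋂ i : Fin d, {z | z i.succ ∈ Set.Ioo (0 : ℝ) 1} := by
    ext z; simp [domDL]
  rw [h]
  refine (isOpen_lt (by fun_prop) (by fun_prop)).inter (isOpen_iInter_of_finite fun i => ?_)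
  exact isOpen_Ioo.preimage (by fun_prop : Continuous fun z : Eucl d => z i.succ)

theorem domDL_subset_closedBox (d : ℕ) (L : ℝ) : domDL d L ⊆ closedBox d L :=
  fun _ hz => ⟨hz.1.le, fun i => Set.Ioo_subset_Icc_self (hz.2 i)⟩

theorem isCompact_closedBox (d : ℕ) (L : ℝ) : IsCompact (closedBox d L) := by
  have h : closedBox d L = (EuclideanSpace.equiv (Fin (d + 1)) ℝ) ⁻¹'
      (Set.univ.pi (Fin.cons (Set.Icc (-L) L) fun _ => Set.Icc (0 : ℝ) 1)) := by
    ext z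
    simp [closedBox, Set.mem_pi, Fin.forall_fin_succ, abs_le]
  rw [h]
  refine (EuclideanSpace.equiv (Fin (d + 1)) ℝ).toHomeomorph.isCompact_preimage.2
    (isCompact_univ_pi fun i => ?_)
  refine Fin.cases ?_ (fun j => ?_) i
  · simpa using isCompact_Icc
  · simpa using isCompact_Icc

theorem volume_domDL (d : ℕ) (L : ℝ) : volume (domDL d L) = ENNReal.ofReal (2 * L) := by
  rw [← (measurePreserving_slabEquiv d).measure_preimage_equiv, slabEquiv_preimage,
    Measure.volume_eq_prod, Measure.prod_prod, crossSection, volume_pi_pi]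
  simp [two_mul]

theorem isFiniteMeasure_restrict_domDL (d : ℕ) (L : ℝ) :
    IsFiniteMeasure ((volume : Measure (Eucl d)).restrict (domDL d L)) :=
  ⟨by rw [Measure.restrict_apply_univ, volume_domDL]; exact ENNReal.ofReal_lt_top⟩

theorem setIntegral_domDL {d : ℕ} {L : ℝ} {f : Eucl d → ℝ} (hf : IntegrableOn f (domDL d L)) :
    ∫ z in domDL d L, f z
      = ∫ y in crossSection d, ∫ t in Set.Ioo (-L) L, f (slabEquiv d (t, y)) := by
  have hmp := measurePreserving_slabEquiv d
  have hemb := (slabEquiv d).measurableEmbedding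
  have hf' := (hmp.integrableOn_comp_preimage hemb).2 hf
  rw [← hmp.setIntegral_preimage_emb hemb]
  rw [slabEquiv_preimage, Measure.volume_eq_prod] at hf' ⊢
  rw [IntegrableOn, ← Measure.prod_restrict] at hf'
  rw [← Measure.prod_restrict]
  exact integral_prod_symm _ hf'

theorem ae_ae_of_ae_domDL {d : ℕ} {L : ℝ} {p : Eucl d → Prop}
    (h : ∀ᵐ z ∂(volume.restrict (domDL d L)), p z) :
    ∀ᵐ y ∂(volume.restrict (crossSection d)), ∀ᵐ t ∂(volume.restrict (Set.Ioo (-L) L)),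
      p (slabEquiv d (t, y)) := by
  have h1 := ((measurePreserving_slabEquiv d).restrict_preimage_emb
    (slabEquiv d).measurableEmbedding (domDL d L)).quasiMeasurePreserving.ae h
  rw [slabEquiv_preimage, Measure.volume_eq_prod, ← Measure.prod_restrict] at h1
  have h2 := Measure.measurePreserving_swap (μ := volume.restrict (crossSection d))
    (ν := (volume : Measure ℝ).restrict (Set.Ioo (-L) L))
  exact Measure.ae_ae_of_ae_prod (h2.quasiMeasurePreserving.ae h1)

section LipschitzOnBox

variable {d : ℕ} {L : ℝ} {v : Eucl d → ℝ} {K : ℝ≥0}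

theorem norm_fderiv_le_on_domDL (hv : LipschitzOnWith K v (closedBox d L)) {z : Eucl d}
    (hz : z ∈ domDL d L) : ‖fderiv ℝ v z‖ ≤ K :=
  norm_fderiv_le_of_lipschitzOn ℝ
    (Filter.mem_of_superset ((isOpen_domDL d L).mem_nhds hz) (domDL_subset_closedBox d L)) hv

theorem ae_differentiableAt_domDL (hv : LipschitzOnWith K v (closedBox d L)) :
    ∀ᵐ z ∂(volume.restrict (domDL d L)), DifferentiableAt ℝ v z := by
  have h := (hv.mono (domDL_subset_closedBox d L)).ae_differentiableWithinAt (μ := volume)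
    (isOpen_domDL d L).measurableSet
  filter_upwards [h, ae_restrict_mem (isOpen_domDL d L).measurableSet] with z hz hzm
  exact hz.differentiableAt ((isOpen_domDL d L).mem_nhds hzm)

theorem integrableOn_fderiv_apply (hv : LipschitzOnWith K v (closedBox d L)) (w : Eucl d) :
    IntegrableOn (fun z => fderiv ℝ v z w) (domDL d L) := by
  have := isFiniteMeasure_restrict_domDL d L
  refine Integrable.of_bound (measurable_fderiv_apply_const ℝ v w).aestronglyMeasurable
    (K * ‖w‖) ?_
  filter_upwards [ae_restrict_mem (isOpen_domDL d L).measurableSet] with z hz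
  exact (ContinuousLinearMap.le_opNorm _ _).trans
    (mul_le_mul_of_nonneg_right (norm_fderiv_le_on_domDL hv hz) (norm_nonneg _))

theorem integrableOn_norm_fderiv_sq (hv : LipschitzOnWith K v (closedBox d L)) :
    IntegrableOn (fun z => ‖fderiv ℝ v z‖ ^ 2) (domDL d L) := by
  have := isFiniteMeasure_restrict_domDL d L
  refine Integrable.of_bound ((measurable_fderiv ℝ v).norm.pow_const 2).aestronglyMeasurable
    ((K : ℝ) ^ 2) ?_
  filter_upwards [ae_restrict_mem (isOpen_domDL d L).measurableSet] with z hz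
  rw [Real.norm_of_nonneg (by positivity)]
  exact pow_le_pow_left₀ (norm_nonneg _) (norm_fderiv_le_on_domDL hv hz) 2

theorem ContinuousOn.integrableOn_domDL {f : Eucl d → ℝ} (hf : ContinuousOn f (closedBox d L)) :
    IntegrableOn f (domDL d L) :=
  (hf.integrableOn_compact (isCompact_closedBox d L)).mono_set (domDL_subset_closedBox d L)

/-- The longitudinal derivative of a Lipschitz function vanishing at both ends of the box has
vanishing integral. -/
theorem integral_fderiv_longVec_eq_zero (hL : 0 < L) (hv : LipschitzOnWith K v (closedBox d L))
    (hbd : ∀ z, |z 0| = L → v z = 0) :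
    ∫ z in domDL d L, fderiv ℝ v z (longVec d) = 0 := by
  rw [setIntegral_domDL (integrableOn_fderiv_apply hv _)]
  have hcross : MeasurableSet (crossSection d) :=
    MeasurableSet.univ_pi fun _ => measurableSet_Ioo
  refine integral_eq_zero_of_ae ?_
  filter_upwards [ae_ae_of_ae_domDL (ae_differentiableAt_domDL hv), ae_restrict_mem hcross]
    with y hy hymem
  set φ : ℝ → ℝ := fun t => v (slabEquiv d (t, y)) with hφ
  have hder : ∀ t, HasDerivAt (fun s => slabEquiv d (s, y)) (longVec d) t := fun t => by
    rw [show (fun s => slabEquiv d (s, y)) = fun s => slabEquiv d (0, y) + s • longVec d from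
      funext fun s => slabEquiv_eq d s y]
    simpa using ((hasDerivAt_id t).smul_const (longVec d)).const_add (slabEquiv d (0, y))
  have hmem : ∀ t ∈ Set.uIcc (-L) L, slabEquiv d (t, y) ∈ closedBox d L := fun t ht => by
    rw [Set.uIcc_of_le (by linarith)] at ht
    refine ⟨?_, fun i => ?_⟩
    · rw [slabEquiv_zero]; exact abs_le.2 ht
    · rw [slabEquiv_succ]; exact Set.Ioo_subset_Icc_self (hymem i trivial)
  have hlip : LipschitzOnWith K φ (Set.uIcc (-L) L) :=
    LipschitzOnWith.of_dist_le_mul fun s hs t ht => by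
      refine (hv.dist_le_mul _ (hmem s hs) _ (hmem t ht)).trans_eq ?_
      rw [slabEquiv_eq d s, slabEquiv_eq d t, dist_add_left, dist_eq_norm, ← sub_smul, norm_smul,
        norm_longVec, mul_one, ← dist_eq_norm]
  have hftc := hlip.absolutelyContinuousOnInterval.integral_deriv_eq_sub
  have h1 : φ L = 0 := hbd _ (by rw [slabEquiv_zero, abs_of_pos hL])
  have h2 : φ (-L) = 0 := hbd _ (by rw [slabEquiv_zero, abs_neg, abs_of_pos hL])
  rw [h1, h2, sub_zero, intervalIntegral.integral_of_le (by linarith),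
    integral_Ioc_eq_integral_Ioo] at hftc
  rw [Pi.zero_apply, ← hftc]
  refine integral_congr_ae ?_
  filter_upwards [hy] with t ht
  exact ((ht.hasFDerivAt.comp_hasDerivAt t (hder t)).deriv).symm

theorem lipschitzOnWith_coord_zero (d : ℕ) (s : Set (Eucl d)) :
    LipschitzOnWith 1 (fun z : Eucl d => z 0) s :=
  LipschitzOnWith.of_dist_le_mul fun x _ y _ => by
    rw [NNReal.coe_one, one_mul, dist_eq_norm, dist_eq_norm]
    exact PiLp.norm_apply_le (x - y) 0

/-- The Poincaré inequality on the box for functions vanishing at both ends. -/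
theorem poincare_box (hL : 0 < L) (hv : LipschitzOnWith K v (closedBox d L))
    (hbd : ∀ z, |z 0| = L → v z = 0) :
    ∫ z in domDL d L, v z ^ 2 ≤ 4 * L ^ 2 * dirEnergy d L v := by
  have hcomp := isCompact_closedBox d L
  obtain ⟨K₁, h₁⟩ := LipschitzOnWith.exists_mul_of_isCompact hcomp hv hv
  obtain ⟨K₂, h₂⟩ := LipschitzOnWith.exists_mul_of_isCompact hcomp
    (lipschitzOnWith_coord_zero d _) h₁
  have hzero := integral_fderiv_longVec_eq_zero hL h₂ fun z hz => by simp [hbd z hz]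
  have hsq : IntegrableOn (fun z => v z ^ 2) (domDL d L) :=
    (hv.continuousOn.pow 2).integrableOn_domDL
  have hE := integrableOn_norm_fderiv_sq hv
  have hpt : ∀ᵐ z ∂(volume.restrict (domDL d L)),
      (1 / 2) * v z ^ 2 ≤ fderiv ℝ (fun z : Eucl d => z 0 * (v z * v z)) z (longVec d)
        + 2 * L ^ 2 * ‖fderiv ℝ v z‖ ^ 2 := by
    filter_upwards [ae_differentiableAt_domDL hv,
      ae_restrict_mem (isOpen_domDL d L).measurableSet] with z hz hzm
    have hc : HasFDerivAt (fun z : Eucl d => z 0) (EuclideanSpace.proj (𝕜 := ℝ) 0) z :=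
      (EuclideanSpace.proj (𝕜 := ℝ) (0 : Fin (d + 1))).hasFDerivAt
    have hprod := hc.mul (hz.hasFDerivAt.mul hz.hasFDerivAt)
    have hf : fderiv ℝ (fun z : Eucl d => z 0 * (v z * v z)) z (longVec d)
        = z 0 * (2 * (v z * fderiv ℝ v z (longVec d))) + v z ^ 2 := by
      have := hprod.fderiv
      erw [this]
      simp [longVec_zero]
      ring
    rw [hf]
    have hp : |fderiv ℝ v z (longVec d)| ≤ ‖fderiv ℝ v z‖ := by
      simpa [norm_longVec] using (fderiv ℝ v z).le_opNorm (longVec d)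
    have hp2 : (z 0 * fderiv ℝ v z (longVec d)) ^ 2 ≤ L ^ 2 * ‖fderiv ℝ v z‖ ^ 2 := by
      rw [mul_pow, ← sq_abs (z 0), ← sq_abs (fderiv ℝ v z (longVec d))]
      have := hzm.1.le
      gcongr
    nlinarith [sq_nonneg (v z + 2 * (z 0 * fderiv ℝ v z (longVec d)))]
  have hint := integral_mono_ae (hsq.const_mul (1 / 2))
    ((integrableOn_fderiv_apply h₂ (longVec d)).add (hE.const_mul (2 * L ^ 2))) hpt
  rw [integral_const_mul] at hint
  have hadd := integral_add (integrableOn_fderiv_apply h₂ (longVec d)) (hE.const_mul (2 * L ^ 2))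
  simp only [Pi.add_apply] at hint hadd
  rw [hadd, hzero, integral_const_mul] at hint
  rw [dirEnergy]
  linarith

/-- The Dirichlet energy of an affine profile of slope `1/L` plus a perturbation vanishing at
both ends of the box. -/
theorem dirEnergy_affine_add (hL : 0 < L) (hv : LipschitzOnWith K v (closedBox d L))
    (hbd : ∀ z, |z 0| = L → v z = 0) {h : Eucl d → ℝ}
    (hh : ∀ z ∈ closedBox d L, h z = z 0 / L + v z) :
    dirEnergy d L h = 2 / L + dirEnergy d L v := by
  have := isFiniteMeasure_restrict_domDL d L
  have hpt : ∀ᵐ z ∂(volume.restrict (domDL d L)), ‖fderiv ℝ h z‖ ^ 2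
      = (1 / L ^ 2 + 2 / L * fderiv ℝ v z (longVec d)) + ‖fderiv ℝ v z‖ ^ 2 := by
    filter_upwards [ae_differentiableAt_domDL hv,
      ae_restrict_mem (isOpen_domDL d L).measurableSet] with z hz hzm
    have hlin : HasFDerivAt (fun z : Eucl d => z 0 / L) (innerSL ℝ ((1 / L) • longVec d)) z := by
      convert (innerSL ℝ ((1 / L) • longVec d)).hasFDerivAt using 1
      ext w
      simp [longVec, EuclideanSpace.inner_single_left, div_eq_inv_mul]
    have heq : h =ᶠ[𝓝 z] fun z => z 0 / L + v z := by
      filter_upwards [(isOpen_domDL d L).mem_nhds hzm] with w hw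
      exact hh w (domDL_subset_closedBox d L hw)
    rw [heq.fderiv_eq]
    erw [(hlin.add hz.hasFDerivAt).fderiv]
    set p := (InnerProductSpace.toDual ℝ (Eucl d)).symm (fderiv ℝ v z) with hp
    have hpd : fderiv ℝ v z = innerSL ℝ p := by
      ext w; simp [hp]
    rw [hpd, ← map_add, innerSL_apply_norm, innerSL_apply_norm, norm_add_sq_real,
      inner_smul_left, norm_smul, norm_longVec, innerSL_apply_apply, real_inner_comm]
    simp
    ring
  have hi : Integrable (fun z => 1 / L ^ 2 + 2 / L * fderiv ℝ v z (longVec d))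
      (volume.restrict (domDL d L)) := (integrable_const _).add
    ((integrableOn_fderiv_apply hv (longVec d)).const_mul (2 / L))
  rw [dirEnergy, integral_congr_ae hpt, integral_add hi (integrableOn_norm_fderiv_sq hv),
    integral_add (integrable_const _) ((integrableOn_fderiv_apply hv (longVec d)).const_mul _),
    integral_const_mul, integral_fderiv_longVec_eq_zero hL hv hbd, dirEnergy]
  simp [Measure.real, volume_domDL, hL.le]
  field_simp

end LipschitzOnBox

section KuhnTriangulation

variable {d : ℕ} {L a : ℝ}

/-- The Kuhn simplex of the lattice cube with corner `a p` attached to the permutation `σ`. -/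
def kuhnSimplex (d : ℕ) (a : ℝ) (p : Fin (d + 1) → ℤ) (σ : Equiv.Perm (Fin (d + 1))) :
    Set (Eucl d) :=
  {z | (∀ i, a * p i ≤ z i ∧ z i ≤ a * p i + a) ∧
    ∀ k l : Fin (d + 1), k ≤ l → z (σ l) - a * p (σ l) ≤ z (σ k) - a * p (σ k)}

theorem isClosed_kuhnSimplex (p : Fin (d + 1) → ℤ) (σ : Equiv.Perm (Fin (d + 1))) :
    IsClosed (kuhnSimplex d a p σ) := by
  simp only [kuhnSimplex, Set.ofPred_and, Set.ofPred_forall]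
  refine (isClosed_iInter fun i => ?_).inter
    (isClosed_iInter fun k => isClosed_iInter fun l => isClosed_iInter fun _ => ?_)
  · exact (isClosed_le (by fun_prop) (by fun_prop)).inter (isClosed_le (by fun_prop) (by fun_prop))
  · exact isClosed_le (by fun_prop) (by fun_prop)

/-- The vertices of a Kuhn simplex, numbered by `0, …, d + 1`. -/
def kuhnVertex (d : ℕ) (a : ℝ) (p : Fin (d + 1) → ℤ) (σ : Equiv.Perm (Fin (d + 1))) (j : ℕ) :
    Eucl d :=
  WithLp.toLp 2 fun i => a * ((p i + if (σ.symm i : ℕ) < j then 1 else 0 : ℤ) : ℝ)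

theorem latticePt_kuhnVertex (p : Fin (d + 1) → ℤ) (σ : Equiv.Perm (Fin (d + 1))) (j : ℕ) :
    latticePt d a (kuhnVertex d a p σ j) := fun _ => ⟨_, rfl⟩

theorem kuhnVertex_mem_kuhnSimplex (ha : 0 < a) (p : Fin (d + 1) → ℤ)
    (σ : Equiv.Perm (Fin (d + 1))) (j : ℕ) :
    kuhnVertex d a p σ j ∈ kuhnSimplex d a p σ := by
  refine ⟨fun i => ?_, fun k l hkl => ?_⟩
  · simp only [kuhnVertex]
    split_ifs <;> push_cast <;> constructor <;> linarith
  · have hkl' : (k : ℕ) ≤ l := hkl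
    simp only [kuhnVertex, Equiv.symm_apply_apply]
    split_ifs
    · push_cast; linarith
    · omega
    · push_cast; linarith
    · push_cast; linarith

theorem kuhnVertex_succ (p : Fin (d + 1) → ℤ) (σ : Equiv.Perm (Fin (d + 1)))
    (j : Fin (d + 1)) :
    kuhnVertex d a p σ (j + 1) = kuhnVertex d a p σ j + a • EuclideanSpace.single (σ j) 1 := by
  ext i
  by_cases hi : i = σ j
  · subst hi
    simp [kuhnVertex]
    ring
  · have hne : (σ.symm i : ℕ) ≠ j := fun h => hi (by
      rw [← Equiv.apply_symm_apply σ i, Fin.ext h])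
    have : (σ.symm i : ℕ) < j + 1 ↔ (σ.symm i : ℕ) < j := by omega
    simp only [kuhnVertex, this]
    simp [hi]

/-- An affine function vanishing at the vertices of a Kuhn simplex vanishes. -/
theorem affine_eq_zero_of_kuhnVertex (ha : 0 < a) {p : Fin (d + 1) → ℤ}
    {σ : Equiv.Perm (Fin (d + 1))} {φ : Eucl d →ᵃ[ℝ] ℝ}
    (h : ∀ j, φ (kuhnVertex d a p σ j) = 0) (z : Eucl d) : φ z = 0 := by
  have hlin : φ.linear = 0 := by
    refine (EuclideanSpace.basisFun (Fin (d + 1)) ℝ).toBasis.ext fun i => ?_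
    have h1 := h ((σ.symm i : ℕ) + 1)
    have h2 : φ (kuhnVertex d a p σ (σ.symm i + 1))
        = φ.linear (a • EuclideanSpace.single (σ (σ.symm i)) 1)
          + φ (kuhnVertex d a p σ (σ.symm i)) := by
      rw [kuhnVertex_succ, add_comm (kuhnVertex d a p σ _)]
      exact φ.map_vadd _ _
    rw [h1, h, add_zero, map_smul, smul_eq_mul, Equiv.apply_symm_apply] at h2
    simpa [ha.ne'] using h2.symm
  have h2 := φ.map_vadd (kuhnVertex d a p σ 0) (z -ᵥ kuhnVertex d a p σ 0)
  rw [vsub_vadd, hlin, h] at h2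
  simpa using h2

theorem exists_mem_kuhnSimplex (ha : 0 < a) {lo hi : Fin (d + 1) → ℤ} (hlt : ∀ i, lo i < hi i)
    {z : Eucl d} (hz : ∀ i, a * lo i ≤ z i ∧ z i ≤ a * hi i) :
    ∃ p σ, z ∈ kuhnSimplex d a p σ ∧ ∀ i, lo i ≤ p i ∧ p i + 1 ≤ hi i := by
  have hcell : ∀ i, ∃ q : ℤ, (lo i ≤ q ∧ q + 1 ≤ hi i) ∧ a * q ≤ z i ∧ z i ≤ a * q + a := by
    intro i
    by_cases htop : ⌊z i / a⌋ + 1 ≤ hi i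
    · refine ⟨⌊z i / a⌋, ⟨?_, htop⟩, ?_, ?_⟩
      · rw [Int.le_floor, le_div_iff₀ ha]; linarith [(hz i).1]
      · have := Int.floor_le (z i / a); rw [le_div_iff₀ ha] at this; linarith
      · have := (Int.lt_floor_add_one (z i / a)).le; rw [div_le_iff₀ ha] at this; linarith
    · have h1 : hi i ≤ ⌊z i / a⌋ := by omega
      rw [Int.le_floor, le_div_iff₀ ha] at h1
      have := hlt i
      refine ⟨hi i - 1, ⟨by omega, by omega⟩, ?_, ?_⟩
      · push_cast; linarith
      · push_cast; linarith [(hz i).2]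
  choose p hp hzp using hcell
  refine ⟨p, Tuple.sort fun i => -(z i - a * p i), ⟨hzp, fun k l hkl => ?_⟩, hp⟩
  have := Tuple.monotone_sort (fun i => -(z i - a * p i)) hkl
  simp only [Function.comp] at this
  linarith

/-- A piecewise linear function is Lipschitz on lattice boxes. -/
theorem IsPLGrid.exists_lipschitzOnWith (ha : 0 < a) {lo hi : Fin (d + 1) → ℤ}
    (hlt : ∀ i, lo i < hi i) {h : Eucl d → ℝ} (hh : IsPLGrid d a h) :
    ∃ K, LipschitzOnWith K h {z | ∀ i, a * lo i ≤ z i ∧ z i ≤ a * hi i} := by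
  choose φ hφ using hh.2
  let ι := ↥(Set.Icc lo hi) × Equiv.Perm (Fin (d + 1))
  have : Fintype ι := Fintype.ofFinite ι
  let A : ι → Eucl d →L[ℝ] ℝ := fun i => LinearMap.toContinuousLinearMap (φ i.1 i.2).linear
  refine ⟨Finset.univ.sup fun i => ‖A i‖₊, lipschitzOnWith_of_finite_closed_cover (ι := ι) ?_
    hh.1.continuousOn (fun i => isClosed_kuhnSimplex (a := a) i.1 i.2) ?_ fun i => ?_⟩
  · simp only [Set.ofPred_forall]
    exact convex_iInter fun i =>
      (convex_Icc _ _).linear_preimage (EuclideanSpace.proj (𝕜 := ℝ) i).toLinearMap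
  · intro z hz
    obtain ⟨p, σ, hzp, hp⟩ := exists_mem_kuhnSimplex ha hlt hz
    have hphi : ∀ i, p i ≤ hi i := fun i => by have := (hp i).2; omega
    exact Set.mem_iUnion.2 ⟨(⟨p, fun i => (hp i).1, hphi⟩, σ), hzp⟩
  · refine LipschitzOnWith.of_dist_le_mul fun x hx y hy => ?_
    rw [hφ _ _ x hx.1.1 hx.1.2, hφ _ _ y hy.1.1 hy.1.2, dist_eq_norm, dist_eq_norm,
      ← vsub_eq_sub, ← AffineMap.linearMap_vsub, vsub_eq_sub]
    refine ((A i).le_opNorm (x - y)).trans (mul_le_mul_of_nonneg_right ?_ (norm_nonneg _))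
    exact_mod_cast Finset.le_sup (f := fun i => ‖A i‖₊) (Finset.mem_univ i)

/-- A piecewise linear function vanishing at the lattice points of a lattice box vanishes on
the box. -/
theorem IsPLGrid.eq_zero_of_lattice (ha : 0 < a) {lo hi : Fin (d + 1) → ℤ}
    (hlt : ∀ i, lo i < hi i) {h : Eucl d → ℝ} (hh : IsPLGrid d a h)
    (h0 : ∀ z, latticePt d a z → (∀ i, a * lo i ≤ z i ∧ z i ≤ a * hi i) → h z = 0)
    {z : Eucl d} (hz : ∀ i, a * lo i ≤ z i ∧ z i ≤ a * hi i) : h z = 0 := by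
  obtain ⟨p, σ, hzp, hp⟩ := exists_mem_kuhnSimplex ha hlt hz
  obtain ⟨φ, hφ⟩ := hh.2 p σ
  rw [hφ z hzp.1 hzp.2]
  refine affine_eq_zero_of_kuhnVertex (p := p) (σ := σ) ha (fun j => ?_) z
  have hv := kuhnVertex_mem_kuhnSimplex ha p σ j
  rw [← hφ _ hv.1 hv.2]
  refine h0 _ (latticePt_kuhnVertex p σ j) fun i => ?_
  have h1 : (lo i : ℝ) ≤ p i := by exact_mod_cast (hp i).1
  have h2 : (p i : ℝ) + 1 ≤ hi i := by exact_mod_cast (hp i).2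
  have h3 := hv.1 i
  exact ⟨by nlinarith, by nlinarith⟩

theorem IsPLGrid.add {f g : Eucl d → ℝ} (hf : IsPLGrid d a f) (hg : IsPLGrid d a g) :
    IsPLGrid d a fun z => f z + g z := by
  refine ⟨hf.1.add hg.1, fun p σ => ?_⟩
  obtain ⟨φ, hφ⟩ := hf.2 p σ
  obtain ⟨ψ, hψ⟩ := hg.2 p σ
  exact ⟨φ + ψ, fun z h1 h2 => by simp [hφ z h1 h2, hψ z h1 h2]⟩

theorem isPLGrid_linear (φ : Eucl d →L[ℝ] ℝ) : IsPLGrid d a φ :=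
  ⟨φ.continuous, fun _ _ => ⟨φ.toLinearMap.toAffineMap, fun _ _ _ => rfl⟩⟩

/-- The closed box is a lattice box. -/
theorem mem_closedBox_iff {n k : ℕ} (hn : 1 = n * a) (hk : L = k * a) (z : Eucl d) :
    z ∈ closedBox d L ↔ ∀ i, a * ((Fin.cons (-k : ℤ) fun _ => 0 : Fin (d + 1) → ℤ) i : ℤ) ≤ z i ∧
      z i ≤ a * ((Fin.cons (k : ℤ) fun _ => (n : ℤ) : Fin (d + 1) → ℤ) i : ℤ) := by
  rw [Fin.forall_fin_succ]
  simp [closedBox, abs_le, hk, mul_comm a, ← hn]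

theorem latticeBox_lt (ha : 0 < a) (hL : 0 < L) {n k : ℕ} (hn : 1 = n * a) (hk : L = k * a)
    (i : Fin (d + 1)) :
    (Fin.cons (-k : ℤ) fun _ => 0 : Fin (d + 1) → ℤ) i
      < (Fin.cons (k : ℤ) fun _ => (n : ℤ) : Fin (d + 1) → ℤ) i := by
  have hk0 : (0 : ℝ) < k := pos_of_mul_pos_left (hk ▸ hL) ha.le
  have hn0 : (0 : ℝ) < n := pos_of_mul_pos_left (hn ▸ one_pos) ha.le
  rw [Nat.cast_pos] at hk0 hn0
  refine Fin.cases ?_ (fun j => ?_) i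
  · simp only [Fin.cons_zero]; omega
  · simp only [Fin.cons_succ]; omega

end KuhnTriangulation

theorem closedBox_subset_closure_domDL {d : ℕ} {L : ℝ} (hL : 0 < L) :
    closedBox d L ⊆ closure (domDL d L) := by
  intro z hz
  set c : Eucl d := slabEquiv d (0, fun _ => 1 / 2) with hc
  have hlim : Tendsto (fun t : ℝ => AffineMap.lineMap z c t) (𝓝[>] 0) (𝓝 z) := by
    have h := (AffineMap.lineMap_continuous (R := ℝ) (p := z) (q := c)).tendsto 0
    rw [AffineMap.lineMap_apply_zero] at h
    exact h.mono_left nhdsWithin_le_nhds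
  refine mem_closure_of_tendsto hlim ?_
  filter_upwards [Ioo_mem_nhdsGT (zero_lt_one' ℝ)] with t ht
  have hcoord : ∀ i, (AffineMap.lineMap z c t : Eucl d) i = (1 - t) * z i + t * c i := fun i => by
    simp [AffineMap.lineMap_apply_module]
  refine ⟨?_, fun i => ?_⟩
  · rw [hcoord, hc, slabEquiv_zero, mul_zero, add_zero, abs_mul, abs_of_pos (sub_pos.2 ht.2)]
    nlinarith [hz.1, ht.1, ht.2]
  · rw [hcoord, hc, slabEquiv_succ]
    have := hz.2 i
    constructor <;> nlinarith [this.1, this.2, ht.1, ht.2]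

namespace Disc

variable {d : ℕ} {L a : ℝ} {n k : ℕ}

theorem interp0_exists_lipschitzOnWith (disc : Disc d L a) (ha : 0 < a) (hL : 0 < L)
    (hn : 1 = n * a) (hk : L = k * a) (g : gridSet d L a → ℝ) :
    ∃ K, LipschitzOnWith K (disc.interp0 g) (closedBox d L) := by
  have hlt : ∀ i, (Fin.cons (-k : ℤ) fun _ => 0 : Fin (d + 1) → ℤ) i
      < (Fin.cons (k : ℤ) fun _ => (n : ℤ) : Fin (d + 1) → ℤ) i := latticeBox_lt ha hL hn hk
  obtain ⟨K, hK⟩ := (disc.interp0_pl g).exists_lipschitzOnWith ha hlt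
  exact ⟨K, hK.mono fun z hz => (mem_closedBox_iff hn hk z).1 hz⟩

theorem interp0_eq_zero_of_abs_eq (disc : Disc d L a) (g : gridSet d L a → ℝ) (z : Eucl d)
    (hz : |z 0| = L) : disc.interp0 g z = 0 := disc.interp0_bd g z hz.ge

/-- The affine profile of slope `1/L` belongs to the discretized configuration space. -/
theorem bc_add_interp0_affine (disc : Disc d L a) (ha : 0 < a) (hL : 0 < L)
    (hn : 1 = n * a) (hk : L = k * a) {z : Eucl d} (hz : z ∈ closedBox d L) :
    disc.bc z + disc.interp0 (fun w => w.1 0 / L) z = z 0 / L := by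
  set ℓ : Eucl d →L[ℝ] ℝ := -(L⁻¹ • EuclideanSpace.proj (𝕜 := ℝ) 0) with hℓ
  have hℓz : ∀ z : Eucl d, ℓ z = -(z 0 / L) := fun z => by simp [hℓ, div_eq_inv_mul]
  have hpl := (disc.bc_pl.add (disc.interp0_pl fun w => w.1 0 / L)).add (isPLGrid_linear ℓ)
  have key := hpl.eq_zero_of_lattice ha (latticeBox_lt (d := d) ha hL hn hk) ?_
    ((mem_closedBox_iff hn hk z).1 hz)
  · simp only [hℓz] at key
    linarith
  · intro w hw hwb
    replace hwb := (mem_closedBox_iff hn hk w).2 hwb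
    simp only [hℓz]
    by_cases hgrid : w ∈ gridSet d L a
    · rw [disc.bc_grid w hgrid, disc.interp0_grid _ w hgrid]
      ring
    · have hgt : L - a < |w 0| := by
        by_contra hcon
        exact hgrid ⟨hw, not_lt.1 hcon, hwb.2⟩
      obtain ⟨m, hm⟩ := hw 0
      have hge : L ≤ |w 0| := by
        rw [hm, abs_mul, abs_of_pos ha, hk, ← Int.cast_abs] at hgt ⊢
        have h1 : (k : ℝ) - 1 < ((|m| : ℤ) : ℝ) := by
          by_contra hcon
          nlinarith [not_lt.1 hcon]
        have h2 : (k : ℤ) ≤ |m| := by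
          have : (k : ℤ) - 1 < |m| := by exact_mod_cast h1
          omega
        have h3 : (k : ℝ) ≤ ((|m| : ℤ) : ℝ) := by exact_mod_cast h2
        nlinarith
      rw [disc.interp0_bd _ w hge]
      have heq : |w 0| = L := le_antisymm hwb.1 hge
      rcases (abs_eq hL.le).1 heq with h | h
      · rw [disc.bc_plus w h.ge, h]; field_simp; ring
      · rw [disc.bc_minus w h.le, h]; field_simp; ring

theorem dirEnergy_discFun (disc : Disc d L a) (ha : 0 < a) (hL : 0 < L)
    (hn : 1 = n * a) (hk : L = k * a) (g : gridSet d L a → ℝ) :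
    dirEnergy d L (discFun d L a disc g)
      = 2 / L + dirEnergy d L (disc.interp0 (g - fun w => w.1 0 / L)) := by
  obtain ⟨K, hK⟩ := disc.interp0_exists_lipschitzOnWith ha hL hn hk (g - fun w => w.1 0 / L)
  refine dirEnergy_affine_add hL hK (disc.interp0_eq_zero_of_abs_eq _) fun z hz => ?_
  rw [← disc.bc_add_interp0_affine ha hL hn hk hz, map_sub, discFun, Pi.sub_apply]
  ring

theorem dirEnergy_interp0_smul (disc : Disc d L a) (t : ℝ) (g : gridSet d L a → ℝ) :
    dirEnergy d L (disc.interp0 (t • g)) = t ^ 2 * dirEnergy d L (disc.interp0 g) := by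
  simp only [dirEnergy, map_smul]
  rw [← integral_const_mul]
  congr 1 with z
  rw [fderiv_const_smul_field, Pi.smul_apply, norm_smul, mul_pow, Real.norm_eq_abs, sq_abs]

theorem dirEnergy_interp0_pos (disc : Disc d L a) (ha : 0 < a) (hL : 0 < L)
    (hn : 1 = n * a) (hk : L = k * a) {g : gridSet d L a → ℝ} (hg : g ≠ 0) :
    0 < dirEnergy d L (disc.interp0 g) := by
  obtain ⟨K, hK⟩ := disc.interp0_exists_lipschitzOnWith ha hL hn hk g
  by_contra hneg
  refine hg (funext fun z => ?_)
  have hpoin := poincare_box hL hK (disc.interp0_eq_zero_of_abs_eq g)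
  have hsq : IntegrableOn (fun z => disc.interp0 g z ^ 2) (domDL d L) :=
    (hK.continuousOn.pow 2).integrableOn_domDL
  have hzero : ∫ z in domDL d L, disc.interp0 g z ^ 2 = 0 :=
    le_antisymm (hpoin.trans (mul_nonpos_of_nonneg_of_nonpos (by positivity) (not_lt.1 hneg)))
      (integral_nonneg fun _ => sq_nonneg _)
  rw [integral_eq_zero_iff_of_nonneg (fun _ => sq_nonneg _) hsq] at hzero
  have hae : disc.interp0 g =ᵐ[volume.restrict (domDL d L)] fun _ => 0 := by
    filter_upwards [hzero] with z hz
    exact pow_eq_zero_iff two_ne_zero |>.1 hz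
  have hcont := (disc.interp0_pl g).1
  have hon := Measure.eqOn_open_of_ae_eq hae (isOpen_domDL d L) hcont.continuousOn
    continuousOn_const
  have hcl := hon.closure hcont continuous_const
  rw [← disc.interp0_grid g z.1 z.2, Pi.zero_apply]
  exact hcl (closedBox_subset_closure_domDL hL ⟨by linarith [z.2.2.1], z.2.2.2⟩)

theorem sobNormSq_interp0 (disc : Disc d L a) (ha : 0 < a) (hL : 0 < L)
    (hn : 1 = n * a) (hk : L = k * a) (g : gridSet d L a → ℝ) :
    sobNormSq d L (disc.interp0 g)
      = dirEnergy d L (disc.interp0 g) + ∫ z in domDL d L, disc.interp0 g z ^ 2 := by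
  obtain ⟨K, hK⟩ := disc.interp0_exists_lipschitzOnWith ha hL hn hk g
  exact integral_add (integrableOn_norm_fderiv_sq hK) (hK.continuousOn.pow 2).integrableOn_domDL

theorem continuous_dirEnergy_interp0 [Finite (gridSet d L a)] (disc : Disc d L a) (ha : 0 < a)
    (hL : 0 < L) (hn : 1 = n * a) (hk : L = k * a) :
    Continuous fun g => dirEnergy d L (disc.interp0 g) := by
  have := Fintype.ofFinite (gridSet d L a)
  have hlip := disc.interp0_exists_lipschitzOnWith ha hL hn hk
  refine continuous_integral_norm_sq (fun g => fderiv ℝ (disc.interp0 g))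
    (fun g h s t => ?_) fun g => ?_
  · obtain ⟨K, hK⟩ := hlip g
    obtain ⟨K', hK'⟩ := hlip h
    filter_upwards [ae_differentiableAt_domDL hK, ae_differentiableAt_domDL hK'] with z hz hz'
    rw [map_add, map_smul, map_smul, fderiv_add (hz.const_smul s) (hz'.const_smul t),
      fderiv_const_smul_field, fderiv_const_smul_field]
    rfl
  · obtain ⟨K, hK⟩ := hlip g
    exact integrableOn_norm_fderiv_sq hK

theorem continuous_sobNormSq_interp0 [Finite (gridSet d L a)] (disc : Disc d L a) (ha : 0 < a)
    (hL : 0 < L) (hn : 1 = n * a) (hk : L = k * a) :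
    Continuous fun g => sobNormSq d L (disc.interp0 g) := by
  have := Fintype.ofFinite (gridSet d L a)
  simp only [disc.sobNormSq_interp0 ha hL hn hk]
  refine (disc.continuous_dirEnergy_interp0 ha hL hn hk).add ?_
  simp only [← Real.norm_eq_abs, ← sq_abs (disc.interp0 _ _)]
  refine continuous_integral_norm_sq (fun g => disc.interp0 g)
    (fun g h s t => ae_of_all _ fun z => by simp) fun g => ?_
  simp only [Real.norm_eq_abs, sq_abs]
  exact ((disc.interp0_pl g).1.pow 2).continuousOn.integrableOn_domDL

/-- Recentring at the affine profile turns `Z₁` into a centred Gaussian integral. -/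
theorem Z1_eq (disc : Disc d L a) (ha : 0 < a) (hL : 0 < L) (hn : 1 = n * a) (hk : L = k * a)
    {ε : ℝ} (hε : 0 < ε) :
    Z1 d L a disc ε = Real.exp (-(1 / (ε * L))) *
      ∫ g, Real.exp (-(1 / (2 * ε)) * dirEnergy d L (disc.interp0 g)) ∂(gridVol d L a disc) := by
  let := disc.gridFin
  have hsplit : ∀ g, Real.exp (-(1 / (2 * ε)) * dirEnergy d L (discFun d L a disc g))
      = Real.exp (-(1 / (ε * L))) * Real.exp (-(1 / (2 * ε)) *
        dirEnergy d L (disc.interp0 (g - fun w => w.1 0 / L))) := fun g => by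
    rw [disc.dirEnergy_discFun ha hL hn hk, ← Real.exp_add]
    congr 1
    field_simp
    ring
  simp only [Z1, hsplit]
  rw [integral_const_mul]
  congr 1
  exact integral_sub_right_eq_self (μ := (volume : Measure (gridSet d L a → ℝ)))
    (fun g => Real.exp (-(1 / (2 * ε)) * dirEnergy d L (disc.interp0 g))) _

end Disc

/-- Bounds on the ratio of the normalization constants of the massive
Gaussian measure on `ℋ₀^{L,a}` and the Gaussian free field on `ℋ^{L,a}`:
`exp(1/(εL)) κ^{-N/2} (1 + CL²)^{-N/2} ≤ Z₃^{ε,κ}/Z₁^ε ≤ exp(1/(εL)) κ^{-N/2}`. -/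
theorem statement12 (d : ℕ) :
    ∃ C : ℝ, 0 < C ∧
      ∀ (L a : ℝ), 0 < L → (∃ n : ℕ, 0 < n ∧ a = 1 / n) → (∃ k : ℕ, 0 < k ∧ L = k * a) →
      ∀ (disc : Disc d L a) (ε κ : ℝ), 0 < ε → 0 < κ →
        Real.exp (1/(ε*L)) * κ ^ (-(gridCard d L a disc : ℝ)/2) *
            (1 + C * L ^ 2) ^ (-(gridCard d L a disc : ℝ)/2)
          ≤ Z3 d L a disc ε κ / Z1 d L a disc ε ∧
        Z3 d L a disc ε κ / Z1 d L a disc ε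
          ≤ Real.exp (1/(ε*L)) * κ ^ (-(gridCard d L a disc : ℝ)/2) := by
  refine ⟨4, by norm_num, ?_⟩
  rintro L a hL ⟨n, hn, rfl⟩ ⟨k, -, hk⟩ disc ε κ hε hκ
  have hn0 : (0 : ℝ) < n := by exact_mod_cast hn
  have ha : (0 : ℝ) < 1 / n := by positivity
  have hna : (1 : ℝ) = n * (1 / n) := by field_simp
  let := disc.gridFin
  obtain ⟨hpos, hlower, hupper⟩ := gaussian_integral_comparison (M := 1 + 4 * L ^ 2)
    (c := 1 / (2 * ε)) (κ := κ)
    (disc.continuous_dirEnergy_interp0 ha hL hna hk)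
    (disc.continuous_sobNormSq_interp0 ha hL hna hk) disc.dirEnergy_interp0_smul
    (fun g hg => disc.dirEnergy_interp0_pos ha hL hna hk hg)
    (fun g => by
      rw [disc.sobNormSq_interp0 ha hL hna hk]
      exact le_add_of_nonneg_right (integral_nonneg fun _ => sq_nonneg _))
    (by positivity)
    (fun g => by
      obtain ⟨K, hK⟩ := disc.interp0_exists_lipschitzOnWith ha hL hna hk g
      have := poincare_box hL hK (disc.interp0_eq_zero_of_abs_eq g)
      rw [disc.sobNormSq_interp0 ha hL hna hk]
      linarith)
    (by positivity) hκ
  have hZ3 : Z3 d L (1 / n) disc ε κ = ∫ g : gridSet d L (1 / n) → ℝ,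
      Real.exp (-(κ * (1 / (2 * ε))) * sobNormSq d L (disc.interp0 g)) := by
    rw [mul_one_div]
    rfl
  have hZ1 : Z1 d L (1 / n) disc ε = Real.exp (-(1 / (ε * L))) *
      ∫ g : gridSet d L (1 / n) → ℝ,
        Real.exp (-(1 / (2 * ε)) * dirEnergy d L (disc.interp0 g)) :=
    disc.Z1_eq ha hL hna hk hε
  have hratio : Z3 d L (1 / n) disc ε κ / Z1 d L (1 / n) disc ε
      = Real.exp (1 / (ε * L)) * (Z3 d L (1 / n) disc ε κ /
        ∫ g : gridSet d L (1 / n) → ℝ,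
          Real.exp (-(1 / (2 * ε)) * dirEnergy d L (disc.interp0 g))) := by
    rw [hZ1, Real.exp_neg]
    field_simp
  rw [hratio, hZ3, mul_assoc]
  refine ⟨mul_le_mul_of_nonneg_left ?_ (Real.exp_pos _).le,
    mul_le_mul_of_nonneg_left ?_ (Real.exp_pos _).le⟩
  · exact (le_div_iff₀ hpos).2 hlower
  · exact (div_le_iff₀ hpos).2 hupper


end
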